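/- Let H be a minimal counterexample to the main theorem: a plane graph with Δ(H)=6, containing no subgraph isomorphic to a diamond or a house, in which every 6-vertex either is not incident with two 4-cycles sharing an edge or is not incident with three cycles of sizes p,q,ℓ for any {p,q,ℓ} ∈ {{3,4,4},{3,3,4}}, that is not totally 7-colorable, and that minimizes |V(H)|+|E(H)| among all such graphs. If f is a 3-face of H incident with a vertex of degree 2, then every vertex of degree 6 incident with f has exactly one neighbor of degree 2. -/

import Mathlib

open SimpleGraph

/-- The degree of a vertex, as `Nat.card` of its neighbor set. -/
noncomputable def vdeg {V : Type*} (G : SimpleGraph V) (v : V) : ℕ :=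
  Nat.card (G.neighborSet v)

/-- `G` has maximum degree exactly `k`. -/
def MaxDegreeEq {V : Type*} (G : SimpleGraph V) (k : ℕ) : Prop :=
  (∀ v, vdeg G v ≤ k) ∧ ∃ v, vdeg G v = k

/-- `G` admits a total `k`-coloring: a coloring of vertices and edges with `k` colors such
that adjacent vertices get distinct colors, edges sharing an endpoint get distinct colors,
and each edge gets a color distinct from those of its endpoints. -/
def TotallyColorable {V : Type*} (G : SimpleGraph V) (k : ℕ) : Prop :=
  ∃ (cv : V → Fin k) (ce : Sym2 V → Fin k),
    (∀ ⦃u v⦄, G.Adj u v → cv u ≠ cv v) ∧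
    (∀ e₁ ∈ G.edgeSet, ∀ e₂ ∈ G.edgeSet, e₁ ≠ e₂ → (∃ x, x ∈ e₁ ∧ x ∈ e₂) →
      ce e₁ ≠ ce e₂) ∧
    (∀ ⦃u v⦄, G.Adj u v → ce s(u, v) ≠ cv u)

/-- The diamond: `K₄` minus one edge. -/
def diamondGraph : SimpleGraph (Fin 4) :=
  SimpleGraph.fromEdgeSet {s(0, 1), s(0, 2), s(0, 3), s(1, 2), s(1, 3)}

/-- The house: a `4`-cycle `1 2 3 4` and a triangle `0 1 4` sharing exactly the edge `{1,4}`
(equivalently, a `5`-cycle plus one chord). -/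
def houseGraph : SimpleGraph (Fin 5) :=
  SimpleGraph.fromEdgeSet {s(0, 1), s(1, 2), s(2, 3), s(3, 4), s(4, 0), s(1, 4)}

/-- `G` contains a (not necessarily induced) subgraph isomorphic to `H`. -/
def ContainsCopy {α β : Type*} (H : SimpleGraph α) (G : SimpleGraph β) : Prop :=
  ∃ f : α → β, Function.Injective f ∧ ∀ ⦃u v⦄, H.Adj u v → G.Adj (f u) (f v)

/-- `v` is incident with two distinct `4`-cycles of `G` that share an edge. -/
def TwoAdjacentFourCyclesAt {V : Type*} (G : SimpleGraph V) (v : V) : Prop :=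
  ∃ (c₁ c₂ : G.Walk v v), c₁.IsCycle ∧ c₂.IsCycle ∧ c₁.length = 4 ∧ c₂.length = 4 ∧
    {e | e ∈ c₁.edges} ≠ {e | e ∈ c₂.edges} ∧ ∃ e, e ∈ c₁.edges ∧ e ∈ c₂.edges

/-- `v` is incident with three pairwise distinct cycles of `G`, of lengths `p`, `q`, `ℓ`. -/
def ThreeCyclesAt {V : Type*} (G : SimpleGraph V) (v : V) (p q ℓ : ℕ) : Prop :=
  ∃ (c₁ c₂ c₃ : G.Walk v v), c₁.IsCycle ∧ c₂.IsCycle ∧ c₃.IsCycle ∧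
    c₁.length = p ∧ c₂.length = q ∧ c₃.length = ℓ ∧
    {e | e ∈ c₁.edges} ≠ {e | e ∈ c₂.edges} ∧
    {e | e ∈ c₁.edges} ≠ {e | e ∈ c₃.edges} ∧
    {e | e ∈ c₂.edges} ≠ {e | e ∈ c₃.edges}

/-- Every `6`-vertex of `G` is not incident with two `4`-cycles sharing an edge, or is not
incident with three cycles of sizes `p, q, ℓ` for any `{p,q,ℓ} ∈ {{3,4,4},{3,3,4}}`. -/
def Good6Vertices {V : Type*} (G : SimpleGraph V) : Prop :=
  ∀ v, vdeg G v = 6 →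
    (¬ TwoAdjacentFourCyclesAt G v) ∨
    (∀ p q ℓ : ℕ, (({p, q, ℓ} : Multiset ℕ) = {3, 4, 4} ∨ ({p, q, ℓ} : Multiset ℕ) = {3, 3, 4}) →
      ¬ ThreeCyclesAt G v p q ℓ)

/-- Reversal of darts, as a permutation. -/
def dartRev {V : Type*} (G : SimpleGraph V) : Equiv.Perm G.Dart :=
  Function.Involutive.toPerm SimpleGraph.Dart.symm SimpleGraph.Dart.symm_involutive

/-- A rotation system (combinatorial embedding) of `G`: a permutation of the darts whose
orbits are exactly the sets of darts emanating from each single vertex. -/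
structure RotationSystem {V : Type*} (G : SimpleGraph V) where
  σ : Equiv.Perm G.Dart
  tail_fixed : ∀ d : G.Dart, (σ d).fst = d.fst
  vertex_cycles : ∀ d d' : G.Dart, d.fst = d'.fst → σ.SameCycle d d'

namespace RotationSystem

variable {V : Type*} {G : SimpleGraph V}

/-- The face-tracing permutation of a rotation system. -/
def φ (R : RotationSystem G) : Equiv.Perm G.Dart :=
  R.σ * dartRev G

/-- Two darts lie on the same face iff they are in the same orbit of the face-tracing
permutation. -/
def faceSetoid (R : RotationSystem G) : Setoid G.Dart where
  r := R.φ.SameCycle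
  iseqv := ⟨fun d => Equiv.Perm.SameCycle.refl _ d, Equiv.Perm.SameCycle.symm,
    Equiv.Perm.SameCycle.trans⟩

/-- The faces of the embedding: orbits of the face-tracing permutation. -/
def Faces (R : RotationSystem G) : Type _ :=
  Quotient R.faceSetoid

/-- The number of faces of the embedding. -/
noncomputable def numFaces (R : RotationSystem G) : ℕ :=
  Nat.card R.Faces

/-- The darts of the face containing the dart `d`. -/
def faceDarts (R : RotationSystem G) (d : G.Dart) : Set G.Dart :=
  {d' | R.φ.SameCycle d d'}

/-- The degree (length of the boundary walk, cut edges counted twice) of the face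
containing the dart `d`. -/
noncomputable def faceDeg (R : RotationSystem G) (d : G.Dart) : ℕ :=
  (R.faceDarts d).ncard

/-- The vertex `v` is incident with the face containing the dart `d`. -/
def FaceIncident (R : RotationSystem G) (v : V) (d : G.Dart) : Prop :=
  ∃ d' ∈ R.faceDarts d, d'.fst = v

/-- A rotation system is a plane embedding when it satisfies Euler's formula
`|V| - |E| + |F| = 2` on each connected component, i.e. `|V| + |F| = |E| + 2c`. -/
def IsPlanarEmbedding [Fintype V] (R : RotationSystem G) : Prop :=
  Fintype.card V + R.numFaces = Nat.card G.edgeSet + 2 * Nat.card G.ConnectedComponent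

end RotationSystem

/-- A graph is planar if it admits a plane embedding. -/
def IsPlanar {V : Type*} [Fintype V] (G : SimpleGraph V) : Prop :=
  ∃ R : RotationSystem G, R.IsPlanarEmbedding

/-- Conditions (1), (2), (3) on graphs in Theorem 1: planar of maximum degree 6, with no
diamond and no house subgraph, and every 6-vertex not incident with two adjacent 4-cycles
or not incident with three cycles of sizes in `{{3,4,4},{3,3,4}}`. -/
def GoodGraph {V : Type*} [Fintype V] (G : SimpleGraph V) : Prop :=
  IsPlanar G ∧ MaxDegreeEq G 6 ∧ ¬ ContainsCopy diamondGraph G ∧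
    ¬ ContainsCopy houseGraph G ∧ Good6Vertices G

/-- `H` is a minimal counterexample to the main theorem: it satisfies conditions (1)–(3),
is not totally 7-colorable, and minimizes `|V| + |E|` among all such graphs. -/
def MinimalCounterexample {V : Type*} [Fintype V] (H : SimpleGraph V) : Prop :=
  GoodGraph H ∧ ¬ TotallyColorable H 7 ∧
    ∀ (n : ℕ) (G : SimpleGraph (Fin n)), GoodGraph G → ¬ TotallyColorable G 7 →
      Fintype.card V + Nat.card H.edgeSet ≤ n + Nat.card G.edgeSet

lemma sc_inv {D : Type*} (p : Equiv.Perm D) (r : D → D → Prop) (hr : Equivalence r)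
    (h : ∀ x, r x (p x)) {x y : D} (hxy : p.SameCycle x y) : r x y := by
  obtain ⟨i, rfl⟩ := hxy
  induction i using Int.induction_on generalizing x with
  | zero => simpa using hr.refl x
  | succ n ih =>
    rw [zpow_add_one, Equiv.Perm.mul_apply]
    exact hr.trans (h x) ih
  | pred n ih =>
    rw [zpow_sub_one, Equiv.Perm.mul_apply]
    refine hr.trans (hr.symm ?_) ih
    simpa using h (p⁻¹ x)

lemma sc_step {D : Type*} (p : Equiv.Perm D) (x : D) : p.SameCycle x (p x) := ⟨1, by simp⟩

lemma exists_restrict {D D' : Type*} (ι : D' → D) (hι : Function.Injective ι) (d0 d1 : D)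
    (hr : ∀ x, x ≠ d0 → x ≠ d1 → ∃ y, ι y = x) (hn : ∀ y, ι y ≠ d0 ∧ ι y ≠ d1)
    (s : Equiv.Perm D) (h0 : s d0 = d0) (h1 : s d1 = d1) :
    ∃ s' : Equiv.Perm D', ∀ y, ι (s' y) = s (ι y) := by
  have key : ∀ y, ∃ z, ι z = s (ι y) := fun y => hr _
    (fun h => (hn y).1 (s.injective (h.trans h0.symm)))
    (fun h => (hn y).2 (s.injective (h.trans h1.symm)))
  choose f hf using key
  have hb : Function.Bijective f := by
    constructor
    · intro x y hxy
      apply hι; apply s.injective; rw [← hf, ← hf, hxy]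
    · intro z
      obtain ⟨y, hy⟩ := hr (s.symm (ι z))
        (fun h => (hn z).1 (by rw [← h0, ← h]; simp))
        (fun h => (hn z).2 (by rw [← h1, ← h]; simp))
      exact ⟨y, hι (by rw [hf, hy]; simp)⟩
  exact ⟨Equiv.ofBijective f hb, hf⟩

lemma sc_lift {D D' : Type*} (ι : D' → D) (hι : Function.Injective ι) (d0 d1 : D)
    (hr : ∀ x, x ≠ d0 → x ≠ d1 → ∃ y, ι y = x) (hn : ∀ y, ι y ≠ d0 ∧ ι y ≠ d1)
    (p : Equiv.Perm D) (p' : Equiv.Perm D') (z0 z1 : D')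
    (h1 : ∀ y, p (ι y) ≠ d0 → p (ι y) ≠ d1 → ι (p' y) = p (ι y))
    (h2 : ∀ y, p (ι y) = d0 → p' y = z0)
    (h3 : ∀ y, p (ι y) = d1 → p' y = z1)
    (h4 : ∃ z, ι z = p d0 ∧ p'.SameCycle z0 z)
    (h5 : ∃ z, ι z = p d1 ∧ p'.SameCycle z1 z) (hd : d0 ≠ d1) {x y : D'}
    (h : p.SameCycle (ι x) (ι y)) : p'.SameCycle x y := by
  classical
  have key : ∀ x : D, ∃ z : D', (x = d0 → z = z0) ∧ (x = d1 → z = z1) ∧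
      (x ≠ d0 → x ≠ d1 → ι z = x) := by
    intro x
    by_cases hx0 : x = d0
    · exact ⟨z0, by grind⟩
    by_cases hx1 : x = d1
    · exact ⟨z1, by grind⟩
    obtain ⟨z, hz⟩ := hr x hx0 hx1
    exact ⟨z, by grind⟩
  choose π hπ using key
  have hπι : ∀ y, π (ι y) = y := fun y => hι ((hπ (ι y)).2.2 (hn y).1 (hn y).2)
  have := sc_inv p (fun a b => p'.SameCycle (π a) (π b))
    ⟨fun _ => Equiv.Perm.SameCycle.refl _ _, fun h => h.symm, fun h h' => h.trans h'⟩ ?_ h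
  · simpa [hπι] using this
  intro x
  by_cases hx0 : x = d0
  · obtain ⟨z, hz, hz'⟩ := h4
    subst hx0
    rw [← hz, hπι, (hπ x).1 rfl]; exact hz'
  by_cases hx1 : x = d1
  · obtain ⟨z, hz, hz'⟩ := h5
    subst hx1
    rw [← hz, hπι, (hπ x).2.1 rfl]; exact hz'
  obtain ⟨y, rfl⟩ := hr x hx0 hx1
  rw [hπι]
  have hs : π (p (ι y)) = p' y := by
    by_cases e0 : p (ι y) = d0
    · rw [h2 y e0]; exact (hπ _).1 e0
    by_cases e1 : p (ι y) = d1
    · rw [h3 y e1]; exact (hπ _).2.1 e1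
    rw [← h1 y e0 e1, hπι]
  rw [hs]; exact sc_step _ _

lemma faces_count {D D' : Type*} [Finite D] (ι : D' → D) (hι : Function.Injective ι) (d0 d1 : D)
    (hr : ∀ x, x ≠ d0 → x ≠ d1 → ∃ y, ι y = x) (hn : ∀ y, ι y ≠ d0 ∧ ι y ≠ d1)
    (p : Equiv.Perm D) (p' : Equiv.Perm D')
    (h1 : ∀ y, p (ι y) ≠ d0 → p (ι y) ≠ d1 → ι (p' y) = p (ι y))
    (h2 : ∀ y, p (ι y) = d0 → ι (p' y) = p d1)
    (h3 : ∀ y, p (ι y) = d1 → ι (p' y) = p d0)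
    (hsep : ¬ p.SameCycle d0 d1) (hp00 : p d0 ≠ d0) (hp11 : p d1 ≠ d1)
    (hpp : p (p d0) ≠ d0) (hppp : p (p (p d0)) = d0) :
    Nat.card (Quotient (Equiv.Perm.SameCycle.setoid p')) + 1 =
      Nat.card (Quotient (Equiv.Perm.SameCycle.setoid p)) := by
  classical
  have hd : d0 ≠ d1 := by rintro rfl; exact hsep (Equiv.Perm.SameCycle.refl _ _)
  have s0 := sc_step p d0
  have s1 := sc_step p d1
  have s00 := s0.trans (sc_step p (p d0))
  have hp01 : p d0 ≠ d1 := fun h => hsep (h ▸ s0)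
  have hp10 : p d1 ≠ d0 := fun h => hsep ((h ▸ s1).symm)
  have hpp1 : p (p d0) ≠ d1 := fun h => hsep (h ▸ s00)
  obtain ⟨y0, hy0⟩ := hr (p d0) hp00 hp01
  obtain ⟨y1, hy1⟩ := hr (p d1) hp10 hp11
  obtain ⟨y2, hy2⟩ := hr (p (p d0)) hpp hpp1
  have e0 : p' y0 = y2 := hι (by rw [h1 y0 (by rwa [hy0]) (by rwa [hy0]), hy0, hy2])
  have e2 : p' y2 = y1 := hι (by rw [h2 y2 (by rw [hy2, hppp]), hy1])
  have merge : p'.SameCycle y0 y1 := by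
    rw [← e2, ← e0]; exact (sc_step _ _).trans (sc_step _ _)
  have lift : ∀ {x y : D'}, p.SameCycle (ι x) (ι y) → p'.SameCycle x y := fun {x y} h =>
    sc_lift ι hι d0 d1 hr hn p p' y1 y0 h1 (fun y hy => hι (by rw [h2 y hy, hy1]))
      (fun y hy => hι (by rw [h3 y hy, hy0])) ⟨y0, hy0, merge.symm⟩ ⟨y1, hy1, merge⟩ hd h
  let M : D → Prop := fun x => p.SameCycle x d0 ∨ p.SameCycle x d1
  have hM0 : ∀ x : D', M (ι x) → p'.SameCycle x y0 := by
    rintro x (h | h)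
    · exact lift (by rw [hy0]; exact h.trans s0)
    · exact (lift (x := x) (y := y1) (by rw [hy1]; exact h.trans s1)).trans merge.symm
  have down : ∀ {x y : D'}, p'.SameCycle x y → p.SameCycle (ι x) (ι y) ∨ (M (ι x) ∧ M (ι y)) := by
    intro x y h
    have hMt : ∀ {a b}, p.SameCycle a b → M a → M b := by
      rintro a b h (h' | h')
      · exact Or.inl (h.symm.trans h')
      · exact Or.inr (h.symm.trans h')
    refine sc_inv p' (fun x y => p.SameCycle (ι x) (ι y) ∨ (M (ι x) ∧ M (ι y)))
      ⟨fun _ => Or.inl (Equiv.Perm.SameCycle.refl _ _), ?_, ?_⟩ ?_ h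
    · rintro x y (h | h)
      · exact Or.inl h.symm
      · exact Or.inr ⟨h.2, h.1⟩
    · rintro x y z (h | h) (h' | h')
      · exact Or.inl (h.trans h')
      · exact Or.inr ⟨hMt h.symm h'.1, h'.2⟩
      · exact Or.inr ⟨h.1, hMt h' h.2⟩
      · exact Or.inr ⟨h.1, h'.2⟩
    · intro x
      by_cases f0 : p (ι x) = d0
      · right
        refine ⟨Or.inl ?_, Or.inr ?_⟩
        · have := sc_step p (ι x); rwa [f0] at this
        · rw [h2 x f0]; exact s1.symm
      by_cases f1 : p (ι x) = d1
      · right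
        refine ⟨Or.inr ?_, Or.inl ?_⟩
        · have := sc_step p (ι x); rwa [f1] at this
        · rw [h3 x f1]; exact s0.symm
      · left; rw [h1 x f0 f1]; exact sc_step _ _
  let g : D → D := fun x => if p.SameCycle x d0 then d1 else x
  have gsound : ∀ x y : D', p'.SameCycle x y ↔ p.SameCycle (g (ι x)) (g (ι y)) := by
    intro x y
    constructor
    · intro h
      rcases down h with h | ⟨ha, hb⟩
      · by_cases hx : p.SameCycle (ι x) d0
        · have hy : p.SameCycle (ι y) d0 := h.symm.trans hx
          simp [g, hx, hy, Equiv.Perm.SameCycle.refl]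
        · have hy : ¬ p.SameCycle (ι y) d0 := fun hy => hx (h.trans hy)
          simp [g, hx, hy, h]
      · have : ∀ z, M z → p.SameCycle (g z) d1 := by
          intro z hz
          by_cases hz0 : p.SameCycle z d0
          · simp [g, hz0, Equiv.Perm.SameCycle.refl]
          · simp only [g, hz0, if_false]
            exact hz.resolve_left hz0
        exact (this _ ha).trans (this _ hb).symm
    · intro h
      by_cases hx : p.SameCycle (ι x) d0 <;> by_cases hy : p.SameCycle (ι y) d0
      · exact lift (hx.trans hy.symm)
      · simp only [g, hx, hy, if_true, if_false] at h
        exact (hM0 x (Or.inl hx)).trans (hM0 y (Or.inr h.symm)).symm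
      · simp only [g, hx, hy, if_true, if_false] at h
        exact (hM0 x (Or.inr h)).trans (hM0 y (Or.inl hy)).symm
      · simp only [g, hx, hy, if_false] at h
        exact lift h
  have gne : ∀ x, ¬ p.SameCycle (g x) d0 := by
    intro x
    by_cases hx : p.SameCycle x d0
    · simp only [g, hx, if_true]; exact fun h => hsep h.symm
    · simpa only [g, hx, if_false] using hx
  let F : Option (Quotient (Equiv.Perm.SameCycle.setoid p')) →
      Quotient (Equiv.Perm.SameCycle.setoid p) := fun o => o.elim (Quotient.mk _ d0)
        (Quotient.lift (fun x => Quotient.mk _ (g (ι x)))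
          (fun x y h => Quotient.sound ((gsound x y).1 h)))
  have hF : Function.Bijective F := by
    constructor
    · rintro (_ | a) (_ | b) h
      · rfl
      · induction b using Quotient.ind with | _ b =>
        exact absurd (Quotient.exact h : p.SameCycle d0 (g (ι b))).symm (gne _)
      · induction a using Quotient.ind with | _ a =>
        exact absurd (Quotient.exact h : p.SameCycle (g (ι a)) d0) (gne _)
      · induction a using Quotient.ind with | _ a =>
        induction b using Quotient.ind with | _ b =>
        exact congrArg some (Quotient.sound
          ((gsound a b).2 (Quotient.exact h : p.SameCycle (g (ι a)) (g (ι b)))))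
    · intro q
      induction q using Quotient.ind with | _ x =>
      by_cases hx : p.SameCycle x d0
      · exact ⟨none, Quotient.sound hx.symm⟩
      · obtain ⟨y, hy⟩ : ∃ y, p.SameCycle (ι y) x := by
          by_cases hx1 : x = d1
          · exact ⟨y1, by rw [hy1, hx1]; exact s1.symm⟩
          · obtain ⟨y, hy⟩ := hr x (by rintro rfl; exact hx (Equiv.Perm.SameCycle.refl _ _)) hx1
            exact ⟨y, by rw [hy]⟩
        refine ⟨some (Quotient.mk _ y), Quotient.sound ?_⟩
        have : ¬ p.SameCycle (ι y) d0 := fun h => hx (hy.symm.trans h)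
        change p.SameCycle (g (ι y)) x
        simpa only [g, this, if_false] using hy
  have hD' : Finite D' := Finite.of_injective ι hι
  rw [← Nat.card_congr (Equiv.ofBijective F hF), Finite.card_option]

/-- Three darts forming a facial triangle. -/
structure Tri {V : Type*} {H : SimpleGraph V} (R : RotationSystem H) (a b c : V) : Prop where
  ab : H.Adj a b
  bc : H.Adj b c
  ca : H.Adj c a
  s1 : R.φ ⟨(a, b), ab⟩ = ⟨(b, c), bc⟩
  s2 : R.φ ⟨(b, c), bc⟩ = ⟨(c, a), ca⟩
  s3 : R.φ ⟨(c, a), ca⟩ = ⟨(a, b), ab⟩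

lemma Tri.rot {V : Type*} {H : SimpleGraph V} {R : RotationSystem H} {a b c : V}
    (T : Tri R a b c) : Tri R b c a := ⟨T.bc, T.ca, T.ab, T.s2, T.s3, T.s1⟩

lemma phi_fst {V : Type*} {H : SimpleGraph V} (R : RotationSystem H) (d : H.Dart) :
    (R.φ d).fst = d.snd := by
  change (R.σ d.symm).fst = d.snd
  rw [R.tail_fixed]; rfl

lemma tri_of_face {V : Type*} [Fintype V] {H : SimpleGraph V} (R : RotationSystem H)
    (d : H.Dart) (hf : R.faceDeg d = 3) :
    ∃ a b c, Tri R a b c ∧ ∀ v, R.FaceIncident v d → v = a ∨ v = b ∨ v = c := by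
  classical
  have f0 := phi_fst R d
  have f1 := phi_fst R (R.φ d)
  have f2 := phi_fst R (R.φ (R.φ d))
  have hne : ∀ x : H.Dart, R.φ x ≠ x := by
    intro x h
    have := phi_fst R x
    rw [h] at this
    exact x.adj.ne this
  have s0 : R.φ.SameCycle d (R.φ d) := sc_step _ _
  have s1 : R.φ.SameCycle d (R.φ (R.φ d)) := s0.trans (sc_step _ _)
  have s2 : R.φ.SameCycle d (R.φ (R.φ (R.φ d))) := s1.trans (sc_step _ _)
  have h2 : R.φ (R.φ d) ≠ d := by
    intro h
    have hsub : R.faceDarts d ⊆ {d, R.φ d} := by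
      intro x hx
      have := sc_inv R.φ (fun x y => (x = d ∨ x = R.φ d) ↔ (y = d ∨ y = R.φ d))
        ⟨fun _ => Iff.rfl, fun h => h.symm, fun h h' => h.trans h'⟩ (by
          intro x
          have i1 : R.φ x = R.φ d ↔ x = d := R.φ.injective.eq_iff
          have i2 : R.φ x = d ↔ x = R.φ d := by
            conv_lhs => rw [← h]
            exact R.φ.injective.eq_iff
          rw [i1, i2]; exact or_comm) (show R.φ.SameCycle d x from hx)
      simpa using this
    have := Set.ncard_le_ncard hsub (Set.toFinite _)
    have h3 := Set.ncard_insert_le d {R.φ d}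
    rw [Set.ncard_singleton] at h3
    unfold RotationSystem.faceDeg at hf
    omega
  have h3 : R.φ (R.φ (R.φ d)) = d := by
    by_contra h3
    have hsub : (({d, R.φ d, R.φ (R.φ d), R.φ (R.φ (R.φ d))} : Finset H.Dart) : Set H.Dart)
        ⊆ R.faceDarts d := by
      intro x hx
      simp only [Finset.coe_insert, Finset.coe_singleton, Set.mem_insert_iff,
        Set.mem_singleton_iff] at hx
      rcases hx with rfl | rfl | rfl | rfl
      · exact Equiv.Perm.SameCycle.refl _ _
      · exact s0
      · exact s1
      · exact s2
    have := Set.ncard_le_ncard hsub (Set.toFinite _)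
    rw [Set.ncard_coe_finset] at this
    have i1 : R.φ (R.φ (R.φ d)) ≠ R.φ d := fun h => h2 (R.φ.injective h)
    rw [Finset.card_eq_of_equiv_fin (n := 4)] at this
    · unfold RotationSystem.faceDeg at hf
      omega
    · apply Finset.equivFinOfCardEq
      have n0 := hne d
      have n1 := hne (R.φ d)
      have n2 := hne (R.φ (R.φ d))
      rw [Finset.card_insert_of_notMem, Finset.card_insert_of_notMem, Finset.card_pair]
      · exact n2.symm
      · simp [n1.symm, i1.symm]
      · simp [n0.symm, Ne.symm h2, Ne.symm h3]
  rw [h3] at f2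
  have adj0 : H.Adj d.fst (R.φ d).fst := by rw [f0]; exact d.adj
  have adj1 : H.Adj (R.φ d).fst (R.φ (R.φ d)).fst := by rw [f1]; exact (R.φ d).adj
  have adj2 : H.Adj (R.φ (R.φ d)).fst d.fst := by rw [f2]; exact (R.φ (R.φ d)).adj
  have q0 : (⟨(d.fst, (R.φ d).fst), adj0⟩ : H.Dart) = d := by
    apply SimpleGraph.Dart.ext; exact Prod.ext rfl f0
  have q1 : (⟨((R.φ d).fst, (R.φ (R.φ d)).fst), adj1⟩ : H.Dart) = R.φ d := by
    apply SimpleGraph.Dart.ext; exact Prod.ext rfl f1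
  have q2 : (⟨((R.φ (R.φ d)).fst, d.fst), adj2⟩ : H.Dart) = R.φ (R.φ d) := by
    apply SimpleGraph.Dart.ext; exact Prod.ext rfl f2
  refine ⟨d.fst, (R.φ d).fst, (R.φ (R.φ d)).fst, ⟨adj0, adj1, adj2, ?_, ?_, ?_⟩, ?_⟩
  · rw [q0, q1]
  · rw [q1, q2]
  · rw [q0, q2, h3]
  · rintro v ⟨x, hx, rfl⟩
    have := sc_inv R.φ (fun x y => (x = d ∨ x = R.φ d ∨ x = R.φ (R.φ d)) ↔
        (y = d ∨ y = R.φ d ∨ y = R.φ (R.φ d)))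
        ⟨fun _ => Iff.rfl, fun h => h.symm, fun h h' => h.trans h'⟩ (by
          intro x
          have i1 : R.φ x = R.φ d ↔ x = d := R.φ.injective.eq_iff
          have i3 : R.φ x = R.φ (R.φ d) ↔ x = R.φ d := R.φ.injective.eq_iff
          have i2 : R.φ x = d ↔ x = R.φ (R.φ d) := by
            conv_lhs => rw [← h3]
            exact R.φ.injective.eq_iff
          rw [i1, i2, i3]; tauto) (show R.φ.SameCycle d x from hx)
    have := this.1 (Or.inl rfl)
    rcases this with rfl | rfl | rfl
    · exact Or.inl rfl
    · exact Or.inr (Or.inl rfl)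
    · exact Or.inr (Or.inr rfl)

lemma edge_count {V : Type*} [Fintype V] {H : SimpleGraph V} {a b : V} (hab : H.Adj a b)
    {n : ℕ} (E : Fin n ≃ V) :
    Nat.card ((H.deleteEdges {s(a, b)}).comap E).edgeSet + 1 = Nat.card H.edgeSet := by
  have e : (H.deleteEdges {s(a, b)}).comap E ≃g H.deleteEdges {s(a, b)} :=
    SimpleGraph.Iso.comap E _
  rw [Nat.card_congr e.mapEdgeSet, SimpleGraph.edgeSet_deleteEdges]
  exact Set.ncard_sdiff_singleton_add_one (by simpa using hab) (Set.toFinite _)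

lemma cc_count {V : Type*} {H : SimpleGraph V} {a b c : V} (hab : H.Adj a b)
    (hbc : H.Adj b c) (hca : H.Adj c a) {n : ℕ} (E : Fin n ≃ V) :
    Nat.card ((H.deleteEdges {s(a, b)}).comap E).ConnectedComponent =
      Nat.card H.ConnectedComponent := by
  have e : (H.deleteEdges {s(a, b)}).comap E ≃g H.deleteEdges {s(a, b)} :=
    SimpleGraph.Iso.comap E _
  rw [Nat.card_congr e.connectedComponentEquiv]
  have hadj : ∀ x y, H.Adj x y → (H.deleteEdges {s(a, b)}).Reachable x y := by
    have r : (H.deleteEdges {s(a, b)}).Reachable a b := by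
      have h1 : (H.deleteEdges {s(a, b)}).Adj a c := by
        simp [SimpleGraph.deleteEdges_adj, hca.symm, hab.ne, hbc.ne']
      have h2 : (H.deleteEdges {s(a, b)}).Adj c b := by
        simp [SimpleGraph.deleteEdges_adj, hbc.symm, hca.ne, hbc.ne']
      exact h1.reachable.trans h2.reachable
    intro x y h
    by_cases he : s(x, y) = s(a, b)
    · rcases Sym2.eq_iff.1 he with ⟨rfl, rfl⟩ | ⟨rfl, rfl⟩
      · exact r
      · exact r.symm
    · exact SimpleGraph.Adj.reachable (by simp only [SimpleGraph.deleteEdges_adj]; exact ⟨h, he⟩)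
  have hreach : ∀ x y, (H.deleteEdges {s(a, b)}).Reachable x y ↔ H.Reachable x y := by
    intro x y
    constructor
    · exact fun h => h.mono (SimpleGraph.deleteEdges_le _)
    · rintro ⟨p⟩
      induction p with
      | nil => exact SimpleGraph.Reachable.refl _
      | cons h _ ih => exact (hadj _ _ h).trans ih
  exact Nat.card_congr (Quot.congr (Equiv.refl V) (fun x y => hreach x y))

lemma planar_del {V : Type*} [Fintype V] {H : SimpleGraph V} (R : RotationSystem H)
    (hR : R.IsPlanarEmbedding) {a b c : V} (T : Tri R a b c) {n : ℕ} (E : Fin n ≃ V) :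
    IsPlanar ((H.deleteEdges {s(a, b)}).comap E) := by
  classical
  obtain ⟨hab, hbc, hca, t1, t2, t3⟩ := T
  set G := (H.deleteEdges {s(a, b)}).comap E with hG
  have hGadj : ∀ x y, G.Adj x y ↔ H.Adj (E x) (E y) ∧ s(E x, E y) ≠ s(a, b) := by
    intro x y; simp [hG, SimpleGraph.deleteEdges_adj]
  let d0 : H.Dart := ⟨(a, b), hab⟩
  let d1 : H.Dart := ⟨(b, a), hab.symm⟩
  let ι : G.Dart → H.Dart := fun x => ⟨(E x.fst, E x.snd), ((hGadj _ _).1 x.adj).1⟩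
  have hι : Function.Injective ι := by
    intro x y h
    have h1 := congrArg (fun z : H.Dart => z.fst) h
    have h2 := congrArg (fun z : H.Dart => z.snd) h
    apply SimpleGraph.Dart.ext
    exact Prod.ext (E.injective h1) (E.injective h2)
  have hr : ∀ x : H.Dart, x ≠ d0 → x ≠ d1 → ∃ y, ι y = x := by
    intro x h0 h1
    have hadj : G.Adj (E.symm x.fst) (E.symm x.snd) := by
      rw [hGadj]
      simp only [Equiv.apply_symm_apply]
      refine ⟨x.adj, fun h => ?_⟩
      rcases Sym2.eq_iff.1 h with ⟨h, h'⟩ | ⟨h, h'⟩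
      · exact h0 (SimpleGraph.Dart.ext _ _ (Prod.ext h h'))
      · exact h1 (SimpleGraph.Dart.ext _ _ (Prod.ext h h'))
    refine ⟨⟨(_, _), hadj⟩, SimpleGraph.Dart.ext _ _ (Prod.ext ?_ ?_)⟩ <;> simp [ι]
  have hn : ∀ y, ι y ≠ d0 ∧ ι y ≠ d1 := by
    intro y
    have := ((hGadj _ _).1 y.adj).2
    constructor
    · intro h
      have h1 : E y.fst = a := congrArg (fun z : H.Dart => z.fst) h
      have h2 : E y.snd = b := congrArg (fun z : H.Dart => z.snd) h
      exact this (by rw [h1, h2])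
    · intro h
      have h1 : E y.fst = b := congrArg (fun z : H.Dart => z.fst) h
      have h2 : E y.snd = a := congrArg (fun z : H.Dart => z.snd) h
      exact this (by rw [h1, h2, Sym2.eq_swap])
  have fne : ∀ x y : H.Dart, x.fst ≠ y.fst → x ≠ y := fun x y h h' => h (by rw [h'])
  have hd : d0 ≠ d1 := fne _ _ hab.ne
  have p0 : R.φ d0 = R.σ d1 := rfl
  have p1 : R.φ d1 = R.σ d0 := rfl
  have σ0 : (R.σ d0).fst = a := R.tail_fixed d0
  have σ1 : (R.σ d1).fst = b := R.tail_fixed d1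
  have hsep : ¬ R.φ.SameCycle d0 d1 := by
    intro h
    have := sc_inv R.φ (fun x y => (x = d0 ∨ x = R.φ d0 ∨ x = R.φ (R.φ d0)) ↔
        (y = d0 ∨ y = R.φ d0 ∨ y = R.φ (R.φ d0)))
        ⟨fun _ => Iff.rfl, fun h => h.symm, fun h h' => h.trans h'⟩ (by
          intro x
          have i1 : R.φ x = R.φ d0 ↔ x = d0 := R.φ.injective.eq_iff
          have i3 : R.φ x = R.φ (R.φ d0) ↔ x = R.φ d0 := R.φ.injective.eq_iff
          have i2 : R.φ x = d0 ↔ x = R.φ (R.φ d0) := by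
            have : R.φ (R.φ (R.φ d0)) = d0 := by rw [t1, t2, t3]
            conv_lhs => rw [← this]
            exact R.φ.injective.eq_iff
          rw [i1, i2, i3]; tauto) h
    rcases this.1 (Or.inl rfl) with h | h | h
    · exact hd h.symm
    · rw [t1] at h
      exact hca.ne (congrArg (fun z : H.Dart => z.snd) h).symm
    · rw [t1, t2] at h
      exact hbc.ne (congrArg (fun z : H.Dart => z.fst) h)
  have n10 : R.σ d1 ≠ d0 := fne _ _ (by rw [σ1]; exact hab.ne')
  have n01 : R.σ d0 ≠ d1 := fne _ _ (by rw [σ0]; exact hab.ne)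
  have n11 : R.σ d1 ≠ d1 := fun h => hsep (by rw [← h, ← p0]; exact sc_step _ _)
  have n00 : R.σ d0 ≠ d0 := fun h => hsep (by
    refine Equiv.Perm.SameCycle.symm ?_
    have := sc_step R.φ d1; rwa [p1, h] at this)
  have nσ : R.σ d0 ≠ R.σ d1 := fun h => hd (R.σ.injective h)
  let s : Equiv.Perm H.Dart := Equiv.swap d0 (R.σ d0) * Equiv.swap d1 (R.σ d1) * R.σ
  have sv : ∀ x, s x = Equiv.swap d0 (R.σ d0) (Equiv.swap d1 (R.σ d1) (R.σ x)) := fun _ => rfl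
  have s0 : s d0 = d0 := by
    rw [sv, Equiv.swap_apply_of_ne_of_ne n01 nσ, Equiv.swap_apply_right]
  have s1 : s d1 = d1 := by
    rw [sv, Equiv.swap_apply_right, Equiv.swap_apply_of_ne_of_ne hd.symm n01.symm]
  have sA : ∀ x, R.σ x = d0 → s x = R.σ d0 := by
    intro x hx
    rw [sv, hx, Equiv.swap_apply_of_ne_of_ne hd n10.symm, Equiv.swap_apply_left]
  have sB : ∀ x, R.σ x = d1 → s x = R.σ d1 := by
    intro x hx
    rw [sv, hx, Equiv.swap_apply_left, Equiv.swap_apply_of_ne_of_ne n10 nσ.symm]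
  have sC : ∀ x, x ≠ d0 → x ≠ d1 → R.σ x ≠ d0 → R.σ x ≠ d1 → s x = R.σ x := by
    intro x h0 h1 h2 h3
    rw [sv, Equiv.swap_apply_of_ne_of_ne h3 (fun h => h1 (R.σ.injective h)),
      Equiv.swap_apply_of_ne_of_ne h2 (fun h => h0 (R.σ.injective h))]
  obtain ⟨σ', hσ'⟩ := exists_restrict ι hι d0 d1 hr hn s s0 s1
  have hfst : ∀ x : G.Dart, (ι x).fst = E x.fst := fun _ => rfl
  obtain ⟨z0, hz0⟩ := hr (R.σ d0) n00 n01
  obtain ⟨z1, hz1⟩ := hr (R.σ d1) n10 n11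
  let R' : RotationSystem G :=
    { σ := σ'
      tail_fixed := by
        intro x
        apply E.injective
        rw [← hfst, ← hfst, hσ']
        by_cases h0 : R.σ (ι x) = d0
        · rw [sA _ h0, R.tail_fixed, ← h0, R.tail_fixed]
        by_cases h1 : R.σ (ι x) = d1
        · rw [sB _ h1, R.tail_fixed, ← h1, R.tail_fixed]
        rw [sC _ (hn x).1 (hn x).2 h0 h1, R.tail_fixed]
      vertex_cycles := by
        intro x y hxy
        have h := R.vertex_cycles (ι x) (ι y) (by rw [hfst, hfst, hxy])
        refine sc_lift ι hι d0 d1 hr hn R.σ σ' z0 z1 ?_ ?_ ?_ ?_ ?_ hd h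
        · intro y h0 h1; rw [hσ', sC _ (hn y).1 (hn y).2 h0 h1]
        · intro y h0; apply hι; rw [hσ', sA _ h0, hz0]
        · intro y h0; apply hι; rw [hσ', sB _ h0, hz1]
        · exact ⟨z0, hz0, Equiv.Perm.SameCycle.refl _ _⟩
        · exact ⟨z1, hz1, Equiv.Perm.SameCycle.refl _ _⟩ }
  have hφ' : ∀ x, ι (R'.φ x) = s (ι x).symm := fun x => hσ' x.symm
  have hsy : ∀ x : G.Dart, (ι x).symm ≠ d0 ∧ (ι x).symm ≠ d1 := fun x => hn x.symm
  refine ⟨R', ?_⟩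
  have hF : R'.numFaces + 1 = R.numFaces := by
    refine faces_count ι hι d0 d1 hr hn R.φ R'.φ ?_ ?_ ?_ hsep ?_ ?_ ?_ ?_
    · intro y h0 h1
      rw [hφ', sC _ (hsy y).1 (hsy y).2 h0 h1]; rfl
    · intro y h0; rw [hφ']; exact sA _ h0
    · intro y h0; rw [hφ']; exact sB _ h0
    · exact n10
    · exact n01
    · rw [t1, t2]; exact fne _ _ hca.ne
    · rw [t1, t2, t3]
  have hE := edge_count hab E
  have hC := cc_count hab hbc hca E
  have hV : Fintype.card (Fin n) = Fintype.card V := Fintype.card_congr E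
  unfold RotationSystem.IsPlanarEmbedding at hR ⊢
  rw [hC, hV]
  change Nat.card G.edgeSet + 1 = _ at hE
  omega

/-- Partial total colouring: the vertices of `S` are uncoloured. -/
def PC {V : Type*} (G : SimpleGraph V) (S : Set V) (cv : V → Fin 7) (ce : Sym2 V → Fin 7) : Prop :=
  (∀ p q, G.Adj p q → p ∉ S → q ∉ S → cv p ≠ cv q) ∧
  (∀ p q r, G.Adj p q → G.Adj p r → q ≠ r → ce s(p, q) ≠ ce s(p, r)) ∧
  (∀ p q, G.Adj p q → p ∉ S → ce s(p, q) ≠ cv p)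

lemma PC.mono {V : Type*} {G : SimpleGraph V} {S S' : Set V} {cv ce} (h : PC G S cv ce)
    (hS : S ⊆ S') : PC G S' cv ce :=
  ⟨fun p q hpq hp hq => h.1 p q hpq (fun h => hp (hS h)) (fun h => hq (hS h)), h.2.1,
    fun p q hpq hp => h.2.2 p q hpq (fun h => hp (hS h))⟩

lemma tc_of_PC {V : Type*} {G : SimpleGraph V} {cv ce} (h : PC G ∅ cv ce) :
    TotallyColorable G 7 := by
  refine ⟨cv, ce, fun u v huv => h.1 u v huv (by simp) (by simp), ?_,
    fun u v huv => h.2.2 u v huv (by simp)⟩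
  rintro e₁ h₁ e₂ h₂ hne ⟨x, hx₁, hx₂⟩
  obtain ⟨q, rfl⟩ := hx₁
  obtain ⟨r, rfl⟩ := hx₂
  exact h.2.1 x q r h₁ h₂ (by rintro rfl; exact hne rfl)

lemma free_color (X : Finset (Fin 7)) (h : X.card ≤ 6) : ∃ c, c ∉ X := by
  by_contra! hc
  have : X = Finset.univ := by ext c; simp [hc c]
  rw [this] at h; simp at h

lemma missing_color {V : Type*} [Fintype V] {H : SimpleGraph V} {w u : V} (hwu : H.Adj w u)
    (ce : Sym2 V → Fin 7) (X : Finset (Fin 7)) (h : X.card + vdeg H w ≤ 7) :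
    ∃ m, m ∉ X ∧ ∀ z, H.Adj w z → z ≠ u → ce s(w, z) ≠ m := by
  classical
  let N : Finset V := Finset.univ.filter (fun z => H.Adj w z)
  have hN : N.card = vdeg H w := by
    unfold vdeg
    rw [Nat.card_eq_fintype_card, SimpleGraph.card_neighborSet_eq_degree,
      ← SimpleGraph.card_neighborFinset_eq_degree]
    congr 1; ext z; simp [N]
  have huN : u ∈ N := by simp [N, hwu]
  have h1 := Finset.card_erase_add_one huN
  obtain ⟨m, hm⟩ := free_color (X ∪ (N.erase u).image (fun z => ce s(w, z))) (by
    have := Finset.card_union_le X ((N.erase u).image (fun z => ce s(w, z)))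
    have := Finset.card_image_le (s := N.erase u) (f := fun z => ce s(w, z))
    omega)
  simp only [Finset.mem_union, not_or] at hm
  refine ⟨m, hm.1, fun z hz hzu hm' => hm.2 ?_⟩
  exact Finset.mem_image.2 ⟨z, by simp [N, hz, hzu], hm'⟩

lemma extend_vertex {V : Type*} {H : SimpleGraph V} {S : Set V} {cv ce} {u v w : V}
    (h : PC H (insert u S) cv ce) (hN : ∀ z, H.Adj u z → z = v ∨ z = w) :
    ∃ cv', PC H S cv' ce := by
  classical
  obtain ⟨c, hc⟩ := free_color {cv v, cv w, ce s(u, v), ce s(u, w)}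
    (Finset.card_le_four.trans (by norm_num))
  simp only [Finset.mem_insert, Finset.mem_singleton, not_or] at hc
  obtain ⟨c1, c2, c3, c4⟩ := hc
  refine ⟨Function.update cv u c, ?_, h.2.1, ?_⟩
  · intro p q hpq hp hq
    by_cases hpu : p = u
    · subst hpu
      have hqp : q ≠ p := hpq.ne'
      rw [Function.update_self, Function.update_of_ne hqp]
      rcases hN q hpq with rfl | rfl <;> assumption
    by_cases hqu : q = u
    · subst hqu
      rw [Function.update_self, Function.update_of_ne hpu]
      rcases hN p hpq.symm with rfl | rfl
      · exact Ne.symm c1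
      · exact Ne.symm c2
    rw [Function.update_of_ne hpu, Function.update_of_ne hqu]
    exact h.1 p q hpq (by simp [hpu, hp]) (by simp [hqu, hq])
  · intro p q hpq hp
    by_cases hpu : p = u
    · subst hpu
      rw [Function.update_self]
      rcases hN q hpq with rfl | rfl
      · exact Ne.symm c3
      · exact Ne.symm c4
    rw [Function.update_of_ne hpu]
    exact h.2.2 p q hpq (by simp [hpu, hp])

lemma extend_edge {V : Type*} {H : SimpleGraph V} {S : Set V} {cv ce} {u v w : V}
    (h : PC (H.deleteEdges {s(u, w)}) S cv ce) (hu : u ∈ S)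
    (hN : ∀ z, H.Adj u z → z = v ∨ z = w) {m : Fin 7} (hm : m ≠ cv w)
    (hmw : ∀ z, H.Adj w z → z ≠ u → ce s(w, z) ≠ m) (huv : ce s(u, v) ≠ m) :
    ∃ ce', PC H S cv ce' := by
  classical
  obtain ⟨k1, k2, k3⟩ := h
  simp only [SimpleGraph.deleteEdges_adj, Set.mem_singleton_iff, Sym2.eq_iff] at k1 k2 k3
  refine ⟨fun e => if e = s(u, w) then m else ce e, ?_, ?_, ?_⟩
  · intro p q hpq
    have := hpq.symm
    have := hpq.ne
    grind
  · intro p q r hpq hpr hqr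
    have := hpq.ne
    have := hpr.ne
    simp only [Sym2.eq_iff]
    grind
  · intro p q hpq hp
    have := hpq.ne
    simp only [Sym2.eq_iff]
    grind

lemma shift_edge {V : Type*} {H : SimpleGraph V} {S : Set V} {cv ce} {u v w x y : V}
    (h : PC (H.deleteEdges {s(u, w)}) S cv ce) (hu : u ∈ S) (hx : x ∈ S) (hxu : x ≠ u)
    (hxv : x ≠ v) (hwx : H.Adj w x) (huw : H.Adj u w)
    (hNu : ∀ z, H.Adj u z → z = v ∨ z = w) (hNx : ∀ z, H.Adj x z → z = y ∨ z = w)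
    {m : Fin 7} (hm : m ≠ cv w) (hw : w ∉ S)
    (hmw : ∀ z, H.Adj w z → z ≠ u → ce s(w, z) ≠ m) (hxy : ce s(x, y) ≠ m)
    (huv : ce s(w, x) ≠ ce s(u, v)) :
    ∃ ce', PC H S cv ce' := by
  classical
  obtain ⟨k1, k2, k3⟩ := h
  have hwxne := hwx.ne
  have huwne := huw.ne
  simp only [SimpleGraph.deleteEdges_adj, Set.mem_singleton_iff, Sym2.eq_iff] at k1 k2 k3
  have hc : ce s(w, x) ≠ cv w := k3 w x ⟨hwx, by grind⟩ hw
  refine extend_edge (ce := fun e => if e = s(w, x) then m else ce e) (v := v)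
    (m := ce s(w, x)) ⟨?_, ?_, ?_⟩ hu hNu hc ?_ ?_
  · simpa only [SimpleGraph.deleteEdges_adj, Set.mem_singleton_iff, Sym2.eq_iff] using k1
  · simp only [SimpleGraph.deleteEdges_adj, Set.mem_singleton_iff, Sym2.eq_iff]
    rintro p q r ⟨hpq, e1⟩ ⟨hpr, e2⟩ hqr
    have := hpq.ne
    have := hpr.ne
    have := k2 p q r ⟨hpq, e1⟩ ⟨hpr, e2⟩ hqr
    grind
  · simp only [SimpleGraph.deleteEdges_adj, Set.mem_singleton_iff, Sym2.eq_iff]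
    rintro p q ⟨hpq, e1⟩ hp
    have := k3 p q ⟨hpq, e1⟩ hp
    grind
  · intro z hz hzu
    have := hz.ne
    have h1 := hmw x hwx hxu
    by_cases hzx : z = x
    · subst hzx; simpa using h1.symm
    · have h2 := k2 w z x ⟨hz, by grind⟩ ⟨hwx, by grind⟩ hzx
      simp only [Sym2.eq_iff]
      grind
  · simp only [Sym2.eq_iff]
    grind

lemma swap_edge {V : Type*} {H : SimpleGraph V} {S : Set V} {cv ce} {u v w : V}
    (h : PC (H.deleteEdges {s(u, w)}) S cv ce) (hu : u ∈ S) (hv : v ∉ S) (hw : w ∉ S)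
    (huv : H.Adj u v) (hvw : H.Adj v w) (huw : H.Adj u w)
    (hNu : ∀ z, H.Adj u z → z = v ∨ z = w)
    (hm : ce s(u, v) ≠ cv w)
    (hmw : ∀ z, H.Adj w z → z ≠ u → ce s(w, z) ≠ ce s(u, v)) :
    ∃ ce', PC (H.deleteEdges {s(u, w)}) S cv ce' ∧ ce' s(u, v) = ce s(v, w) ∧
      ce' s(v, w) = ce s(u, v) ∧ ∀ e, e ≠ s(u, v) → e ≠ s(v, w) → ce' e = ce e := by
  classical
  obtain ⟨k1, k2, k3⟩ := h
  have n1 := huv.ne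
  have n2 := hvw.ne
  have n3 := huw.ne
  simp only [SimpleGraph.deleteEdges_adj, Set.mem_singleton_iff, Sym2.eq_iff] at k1 k2 k3
  have c1 : ce s(v, u) ≠ cv v := k3 v u ⟨huv.symm, by grind⟩ hv
  have c2 : ce s(v, w) ≠ cv v := k3 v w ⟨hvw, by grind⟩ hv
  have c3 : ce s(w, v) ≠ cv w := k3 w v ⟨hvw.symm, by grind⟩ hw
  have c4 : ce s(v, u) ≠ ce s(v, w) := k2 v u w ⟨huv.symm, by grind⟩ ⟨hvw, by grind⟩ n3
  have cu : ∀ r, H.Adj v r → r ≠ u → ce s(v, r) ≠ ce s(v, u) := fun r hr hru =>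
    k2 v r u ⟨hr, by grind⟩ ⟨huv.symm, by grind⟩ hru
  have cw : ∀ r, H.Adj v r → r ≠ w → ce s(v, r) ≠ ce s(v, w) := fun r hr hru =>
    k2 v r w ⟨hr, by grind⟩ ⟨hvw, by grind⟩ hru
  have cz : ∀ r, H.Adj w r → r ≠ u → r ≠ v → ce s(w, r) ≠ ce s(w, v) := fun r hr hru hrv =>
    k2 w r v ⟨hr, by grind⟩ ⟨hvw.symm, by grind⟩ hrv
  have e1 : s(v, u) = s(u, v) := Sym2.eq_swap
  have e2 : s(w, v) = s(v, w) := Sym2.eq_swap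
  refine ⟨fun e => if e = s(u, v) then ce s(v, w) else if e = s(v, w) then ce s(u, v) else ce e,
    ⟨?_, ?_, ?_⟩, ?_, ?_, ?_⟩
  · simpa only [SimpleGraph.deleteEdges_adj, Set.mem_singleton_iff, Sym2.eq_iff] using k1
  · simp only [SimpleGraph.deleteEdges_adj, Set.mem_singleton_iff, Sym2.eq_iff]
    rintro p q r ⟨hpq, f1⟩ ⟨hpr, f2⟩ hqr
    have := k2 p q r ⟨hpq, f1⟩ ⟨hpr, f2⟩ hqr
    clear k1 k2 k3
    grind
  · simp only [SimpleGraph.deleteEdges_adj, Set.mem_singleton_iff, Sym2.eq_iff]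
    rintro p q ⟨hpq, f1⟩ hp
    have := k3 p q ⟨hpq, f1⟩ hp
    clear k1 k2 k3
    grind
  · simp
  · have : s(v, w) ≠ s(u, v) := by simp only [ne_eq, Sym2.eq_iff]; grind
    simp [this]
  · intro e h1 h2; simp [h1, h2]

lemma nbrs_two {V : Type*} [Fintype V] {H : SimpleGraph V} {x w : V} (hx : vdeg H x = 2)
    (hw : H.Adj x w) : ∃ y, y ≠ w ∧ H.Adj x y ∧ ∀ z, H.Adj x z → z = y ∨ z = w := by
  have h : (H.neighborSet x).ncard = 2 := hx
  obtain ⟨p, q, hpq, hs⟩ := Set.ncard_eq_two.1 h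
  have hm : ∀ z, H.Adj x z ↔ z = p ∨ z = q := by
    intro z
    rw [← SimpleGraph.mem_neighborSet, hs]; simp
  rcases (hm w).1 hw with rfl | rfl
  · exact ⟨q, hpq.symm, (hm q).2 (Or.inr rfl), fun z hz => ((hm z).1 hz).symm⟩
  · exact ⟨p, hpq, (hm p).2 (Or.inl rfl), fun z hz => (hm z).1 hz⟩

lemma edge_sets_ne {α β : Type*} (f : α → β) (hf : Function.Injective f) {l l' : List (Sym2 α)}
    (h : {e | e ∈ l} ≠ {e | e ∈ l'}) :
    {e | e ∈ l.map (Sym2.map f)} ≠ {e | e ∈ l'.map (Sym2.map f)} := by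
  intro h'
  apply h
  ext e
  have := Set.ext_iff.1 h' (Sym2.map f e)
  simpa [(Sym2.map.injective hf).eq_iff] using this

lemma reduce {V : Type*} [Fintype V] {H : SimpleGraph V} (hmin : MinimalCounterexample H)
    (R : RotationSystem H) (hR : R.IsPlanarEmbedding) {a b c z : V} (T : Tri R a b c)
    (hz : vdeg H z = 6) (hza : z ≠ a) (hzb : z ≠ b) :
    ∃ cv ce, PC (H.deleteEdges {s(a, b)}) ∅ cv ce := by
  classical
  obtain ⟨⟨_, ⟨hdeg, _⟩, hdi, hho, h6⟩, hnc, hmn⟩ := hmin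
  let E : Fin (Fintype.card V) ≃ V := (Fintype.equivFin V).symm
  have hpl := planar_del R hR T E
  have hec := edge_count T.ab E
  set G := (H.deleteEdges {s(a, b)}).comap E with hG
  have hGadj : ∀ x y, G.Adj x y ↔ H.Adj (E x) (E y) ∧ s(E x, E y) ≠ s(a, b) := by
    intro x y; simp [hG, SimpleGraph.deleteEdges_adj]
  have hle : ∀ x, vdeg G x ≤ vdeg H (E x) := by
    intro x
    refine Nat.card_le_card_of_injective
      (fun y : G.neighborSet x => (⟨E y, ((hGadj _ _).1 y.2).1⟩ : H.neighborSet (E x))) ?_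
    intro y y' h
    exact Subtype.ext (E.injective (congrArg Subtype.val h))
  have hz' : vdeg H z ≤ vdeg G (E.symm z) := by
    refine Nat.card_le_card_of_injective
      (fun y : H.neighborSet z => (⟨E.symm y, (hGadj _ _).2 ?_⟩ : G.neighborSet (E.symm z))) ?_
    · simp only [Equiv.apply_symm_apply]
      refine ⟨y.2, fun h => ?_⟩
      rcases Sym2.eq_iff.1 h with ⟨h, _⟩ | ⟨h, _⟩
      · exact hza h
      · exact hzb h
    · intro y y' h
      exact Subtype.ext (E.symm.injective (congrArg Subtype.val h))
  let f : G →g H := ⟨E, fun h => ((hGadj _ _).1 h).1⟩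
  have hfi : Function.Injective f := E.injective
  have hgood : GoodGraph G := by
    refine ⟨hpl, ⟨fun v => (hle v).trans (hdeg _), E.symm z, ?_⟩, ?_, ?_, ?_⟩
    · have := hle (E.symm z)
      rw [Equiv.apply_symm_apply] at this
      omega
    · rintro ⟨g, hg, hga⟩
      exact hdi ⟨f ∘ g, hfi.comp hg, fun u v huv => f.map_adj (hga huv)⟩
    · rintro ⟨g, hg, hga⟩
      exact hho ⟨f ∘ g, hfi.comp hg, fun u v huv => f.map_adj (hga huv)⟩
    · intro v hv
      have hv' : vdeg H (f v) = 6 := le_antisymm (hdeg _) (hv ▸ hle v)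
      rcases h6 (f v) hv' with h | h
      · left
        rintro ⟨c₁, c₂, i1, i2, l1, l2, hne, e, he1, he2⟩
        refine h ⟨c₁.map f, c₂.map f, i1.map hfi, i2.map hfi, by simpa, by simpa, ?_,
          Sym2.map f e, ?_, ?_⟩
        · rw [SimpleGraph.Walk.edges_map, SimpleGraph.Walk.edges_map]
          exact edge_sets_ne f hfi hne
        · rw [SimpleGraph.Walk.edges_map]; exact List.mem_map_of_mem he1
        · rw [SimpleGraph.Walk.edges_map]; exact List.mem_map_of_mem he2
      · right
        rintro p q l hpql ⟨c₁, c₂, c₃, i1, i2, i3, l1, l2, l3, n1, n2, n3⟩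
        refine h p q l hpql ⟨c₁.map f, c₂.map f, c₃.map f, i1.map hfi, i2.map hfi, i3.map hfi,
          by simpa, by simpa, by simpa, ?_, ?_, ?_⟩ <;>
        · rw [SimpleGraph.Walk.edges_map, SimpleGraph.Walk.edges_map]
          exact edge_sets_ne f hfi (by assumption)
  have htc : TotallyColorable G 7 := by
    by_contra hcon
    have := hmn _ G hgood hcon
    omega
  obtain ⟨cv, ce, k1, k2, k3⟩ := htc
  have hadj : ∀ p q, (H.deleteEdges {s(a, b)}).Adj p q → G.Adj (E.symm p) (E.symm q) := by
    intro p q h; simpa [hG] using h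
  refine ⟨fun p => cv (E.symm p), fun e => ce (e.map E.symm), ?_, ?_, ?_⟩
  · intro p q h _ _
    exact k1 (hadj p q h)
  · intro p q r h h' hqr
    refine k2 _ (hadj p q h) _ (hadj p r h') ?_ ⟨E.symm p, by simp, by simp⟩
    intro he
    have := Sym2.map.injective E.symm.injective (a₁ := s(p, q)) (a₂ := s(p, r)) he
    exact hqr (Sym2.congr_right.1 this)
  · intro p q h _
    exact k3 (hadj p q h)

lemma core {V : Type*} [Fintype V] {H : SimpleGraph V} (hmin : MinimalCounterexample H)
    {u v w : V} (huv : H.Adj u v) (hvw : H.Adj v w) (huw : H.Adj u w)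
    (hu2 : vdeg H u = 2) (hw6 : vdeg H w = 6)
    (hduv : ∃ cv ce, PC (H.deleteEdges {s(u, v)}) ∅ cv ce)
    (hduw : vdeg H v = 6 → ∃ cv ce, PC (H.deleteEdges {s(u, w)}) ∅ cv ce) :
    ∃! x, H.Adj w x ∧ vdeg H x = 2 := by
  have hnc := hmin.2.1
  have hdeg := hmin.1.2.1.1
  have hNu : ∀ z, H.Adj u z → z = v ∨ z = w := by
    obtain ⟨y, hy, hy', hN⟩ := nbrs_two hu2 huw
    rcases hN v huv with rfl | h
    · exact hN
    · exact absurd h hvw.ne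
  have hv6 : vdeg H v = 6 := by
    by_contra hv
    have hv5 : vdeg H v ≤ 5 := by have := hdeg v; omega
    obtain ⟨cv, ce, h⟩ := hduv
    obtain ⟨m, hmX, hm⟩ := missing_color huv.symm ce {cv v, ce s(u, w)} (by
      have := Finset.card_le_two (a := cv v) (b := ce s(u, w)); omega)
    simp only [Finset.mem_insert, Finset.mem_singleton, not_or] at hmX
    obtain ⟨ce', h'⟩ := extend_edge (S := insert u ∅) (v := w) (h.mono (by simp)) (by simp)
      (fun z hz => (hNu z hz).symm) hmX.1 hm (Ne.symm hmX.2)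
    obtain ⟨cv', h''⟩ := extend_vertex h' hNu
    exact hnc (tc_of_PC h'')
  refine ⟨u, ⟨huw.symm, hu2⟩, ?_⟩
  rintro x ⟨hwx, hx2⟩
  by_contra hxu
  have hxv : x ≠ v := by rintro rfl; omega
  obtain ⟨y, hyw, hxy, hNx⟩ := nbrs_two hx2 hwx.symm
  obtain ⟨cv, ce, h⟩ := hduw hv6
  have fin : ∀ ce', ¬ PC H (insert u (insert x ∅)) cv ce' := by
    intro ce' h'
    obtain ⟨cv', h''⟩ := extend_vertex h' hNu
    obtain ⟨cv'', h'''⟩ := extend_vertex h'' hNx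
    exact hnc (tc_of_PC h''')
  replace h := h.mono (Set.empty_subset (insert u (insert x ∅)))
  have huS : u ∈ (insert u (insert x ∅) : Set V) := by simp
  have hxS : x ∈ (insert u (insert x ∅) : Set V) := by simp
  have hvS : v ∉ (insert u (insert x ∅) : Set V) := by simp [huv.ne', hxv.symm]
  have hwS : w ∉ (insert u (insert x ∅) : Set V) := by simp [huw.ne', hwx.ne]
  obtain ⟨m, hmX, hm⟩ := missing_color huw.symm ce {cv w} (by simp [hw6])
  simp only [Finset.mem_singleton] at hmX
  have huvm : ce s(u, v) = m := by
    by_contra hne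
    obtain ⟨ce', h'⟩ := extend_edge h huS hNu hmX hm hne
    exact fin ce' h'
  subst huvm
  have hxym : ce s(x, y) = ce s(u, v) := by
    by_contra hne
    obtain ⟨ce', h'⟩ := shift_edge h huS hxS hxu hxv hwx huw hNu hNx hmX hwS hm hne
      (hm x hwx hxu)
    exact fin ce' h'
  obtain ⟨ce₁, h₁, q1, q2, q3⟩ := swap_edge h huS hvS hwS huv hvw huw hNu hmX hm
  have nadj : ∀ z, H.Adj w z → z ≠ u → (H.deleteEdges {s(u, w)}).Adj w z := by
    intro z hz hzu
    simp only [SimpleGraph.deleteEdges_adj, Set.mem_singleton_iff, Sym2.eq_iff]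
    exact ⟨hz, by rintro (⟨rfl, h⟩ | ⟨_, h⟩) <;> [exact huw.ne rfl; exact hzu h]⟩
  have hwv : s(w, v) = s(v, w) := Sym2.eq_swap
  have b1 : ce s(v, w) ≠ cv w := by
    rw [← hwv]; exact h.2.2 w v (nadj v hvw.symm huv.ne') hwS
  have b2 : ce s(v, w) ≠ ce s(u, v) := by
    rw [← hwv]; exact hm v hvw.symm huv.ne'
  have old : ∀ z, H.Adj w z → z ≠ u → z ≠ v → ce₁ s(w, z) = ce s(w, z) := by
    intro z hz hzu hzv
    apply q3
    · intro h
      rcases Sym2.eq_iff.1 h with ⟨h, _⟩ | ⟨h, _⟩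
      · exact huw.ne h.symm
      · exact hvw.ne h.symm
    · intro h
      rcases Sym2.eq_iff.1 h with ⟨h, _⟩ | ⟨_, h⟩
      · exact hvw.ne h.symm
      · exact hzv h
  have b3 : ∀ z, H.Adj w z → z ≠ u → ce₁ s(w, z) ≠ ce s(v, w) := by
    intro z hz hzu
    by_cases hzv : z = v
    · subst hzv; rw [hwv, q2]; exact b2.symm
    · rw [old z hz hzu hzv, ← hwv]
      exact h.2.1 w z v (nadj z hz hzu) (nadj v hvw.symm huv.ne') hzv
  have b4 : ce₁ s(x, y) = ce s(x, y) := by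
    apply q3
    · intro h
      rcases Sym2.eq_iff.1 h with ⟨h, _⟩ | ⟨h, _⟩
      · exact hxu h
      · exact hxv h
    · intro h
      rcases Sym2.eq_iff.1 h with ⟨h, _⟩ | ⟨h, _⟩
      · exact hxv h
      · exact hwx.ne h.symm
  obtain ⟨ce', h'⟩ := shift_edge h₁ huS hxS hxu hxv hwx huw hNu hNx b1 hwS b3
    (by rw [b4, hxym]; exact b2.symm) (by rw [q1]; exact b3 x hwx hxu)
  exact fin ce' h'

/-- **Lemma (3-faces with a 2-vertex).** In a minimal counterexample, if a 3-face is
incident with a vertex of degree 2, then every vertex of degree 6 incident with this face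
has exactly one neighbor of degree 2. -/
theorem minimal_counterexample_three_face_six_vertex_unique_two_neighbor
    {V : Type*} [Fintype V] (H : SimpleGraph V)
    (hmin : MinimalCounterexample H)
    (R : RotationSystem H) (hR : R.IsPlanarEmbedding)
    (d : H.Dart) (hf : R.faceDeg d = 3)
    (h2 : ∃ v, R.FaceIncident v d ∧ vdeg H v = 2)
    (w : V) (hw : R.FaceIncident w d) (hw6 : vdeg H w = 6) :
    ∃! x, H.Adj w x ∧ vdeg H x = 2 := by

  obtain ⟨u, hu, hu2⟩ := h2
  obtain ⟨a, b, c, T, hinc⟩ := tri_of_face R d hf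
  have huw : u ≠ w := by rintro rfl; omega
  have key : ∀ a b c, Tri R a b c → u = a → (w = b ∨ w = c) →
      ∃! x, H.Adj w x ∧ vdeg H x = 2 := by
    rintro a b c T rfl (rfl | rfl)
    · refine core hmin T.ca.symm T.bc.symm T.ab hu2 hw6 ?_ ?_
      · rw [Sym2.eq_swap]
        exact reduce hmin R hR T.rot.rot hw6 T.bc.ne T.ab.ne'
      · intro hc
        exact reduce hmin R hR T hc T.ca.ne T.bc.ne'
    · refine core hmin T.ab T.bc T.ca.symm hu2 hw6 ?_ ?_
      · exact reduce hmin R hR T hw6 T.ca.ne T.bc.ne'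
      · intro hc
        rw [Sym2.eq_swap]
        exact reduce hmin R hR T.rot.rot hc T.bc.ne T.ab.ne'
  have h1 := hinc u hu
  have h2 := hinc w hw
  rcases h1 with h | h | h
  · exact key a b c T h (by rcases h2 with h2 | h2 | h2 <;> simp_all)
  · exact key b c a T.rot h (by rcases h2 with h2 | h2 | h2 <;> simp_all)
  · exact key c a b T.rot.rot h (by rcases h2 with h2 | h2 | h2 <;> simp_all)
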